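/- For an integer n ≥ 2, a real B > 0 and boundary angles α, β ∈ ℝ, define Z_n(B; α, β) = ∫_{(−π,π]^{n−1}} exp( B Σ_{j=1}^{n} cos(θ_j − θ_{j−1}) ) dθ_1 ⋯ dθ_{n−1}, where θ_0 = α and θ_n = β. Let (B_n) be a sequence of positive reals with B_n / n → b ∈ (0,∞). Then for any α, β, α′, β′ ∈ ℝ, Z_n(B_n; α, β) / Z_n(B_n; α′, β′) → [ Σ_{m∈ℤ} exp( −(b/2)(β − α + 2πm)² ) ] / [ Σ_{m∈ℤ} exp( −(b/2)(β′ − α′ + 2πm)² ) ] as n → ∞. -/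

import Mathlib

open MeasureTheory Real Filter

/-- The angle at node `j ∈ {0, 1, ..., n}` of the chain: `α` at `j = 0`, the interior
angle `θ_j` for `1 ≤ j ≤ n - 1`, and `β` at `j = n`. -/
noncomputable def chainNode (n : ℕ) (α β : ℝ) (θ : Fin (n - 1) → ℝ) (j : ℕ) : ℝ :=
  if j = 0 then α else if hj : j - 1 < n - 1 then θ ⟨j - 1, hj⟩ else β

/-- The partition function `Z_n(B; α, β)` of the one-dimensional XY chain on a path with
`n` edges at inverse temperature `B`, with boundary angles pinned at `α` and `β` and the
`n - 1` interior angles integrated over `(-π, π]`. -/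
noncomputable def chainZ (n : ℕ) (B α β : ℝ) : ℝ :=
  ∫ θ : Fin (n - 1) → ℝ,
      Real.exp (B * ∑ j ∈ Finset.range n,
        Real.cos (chainNode n α β θ (j + 1) - chainNode n α β θ j))
    ∂(Measure.pi fun _ => volume.restrict (Set.Ioc (-π) π))

/-- The periodized Gaussian `∑_{m ∈ ℤ} exp(-(b/2)(Δ + 2πm)²)`. -/
noncomputable def wrappedGaussian (b Δ : ℝ) : ℝ :=
  ∑' m : ℤ, Real.exp (-(b / 2) * (Δ + 2 * π * m) ^ 2)

/-- The unnormalised Fourier coefficient `∫_{-π}^{π} exp(B cos x) cos(kx) dx` of the von Mises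
weight, that is `2π I_k(B)` with `I_k` the modified Bessel function. -/
noncomputable def vonMisesCoeff (B : ℝ) (k : ℤ) : ℝ :=
  ∫ x in (-π)..π, Real.exp (B * Real.cos x) * Real.cos (k * x)

/-- The Fourier coefficient of `(1 + cos x)^m`, a multiple of the law of a lazy random walk. -/
noncomputable def lazyWalkCoeff (m : ℕ) (k : ℤ) : ℝ :=
  ∫ x in (-π)..π, (1 + Real.cos x) ^ m * Real.cos (k * x)

lemma lazyWalkCoeff_succ (m : ℕ) (k : ℤ) :
    lazyWalkCoeff (m + 1) k =
      lazyWalkCoeff m k + (lazyWalkCoeff m (k - 1) + lazyWalkCoeff m (k + 1)) / 2 := by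
  unfold lazyWalkCoeff
  rw [← intervalIntegral.integral_add, ← intervalIntegral.integral_div,
    ← intervalIntegral.integral_add]
  · congr 1 with x
    push_cast
    have h1 : ((k : ℝ) - 1) * x = k * x - x := by ring
    have h2 : ((k : ℝ) + 1) * x = k * x + x := by ring
    rw [h1, h2, Real.cos_sub, Real.cos_add]
    ring
  all_goals exact Continuous.intervalIntegrable (by fun_prop) _ _

lemma lazyWalkCoeff_neg (m : ℕ) (k : ℤ) : lazyWalkCoeff m (-k) = lazyWalkCoeff m k := by
  simp [lazyWalkCoeff]

lemma lazyWalkCoeff_zero_left {k : ℤ} (hk : k ≠ 0) : lazyWalkCoeff 0 k = 0 := by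
  have hk' : (k : ℝ) ≠ 0 := by exact_mod_cast hk
  have hs : Real.sin (k * π) = 0 := Real.sin_int_mul_pi k
  simp [lazyWalkCoeff, intervalIntegral.integral_comp_mul_left (fun x => Real.cos x) hk', hs]

lemma lazyWalkCoeff_unimodal (m : ℕ) : ∀ k : ℕ,
    0 ≤ lazyWalkCoeff m k ∧ lazyWalkCoeff m (k + 1) ≤ lazyWalkCoeff m k := by
  induction m with
  | zero =>
    have h0 : 0 ≤ lazyWalkCoeff 0 0 := by
      simp [lazyWalkCoeff]
      positivity
    intro k
    rw [lazyWalkCoeff_zero_left (k := (k : ℤ) + 1) (by omega)]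
    rcases k with _ | k
    · exact ⟨h0, h0⟩
    · rw [lazyWalkCoeff_zero_left (by omega)]
      simp
  | succ m ih =>
    intro k
    rw [lazyWalkCoeff_succ, lazyWalkCoeff_succ]
    rcases k with _ | k
    · have h0 := ih 0
      have h1 := ih 1
      have hn := lazyWalkCoeff_neg m 1
      norm_num at h0 h1 ⊢
      rw [hn]
      constructor <;> linarith [h1.2]
    · have h0 := ih k
      have h1 := ih (k + 1)
      have h2 := ih (k + 2)
      push_cast at *
      have e1 : (k : ℤ) + 1 + 1 = k + 2 := by ring
      have e2 : (k : ℤ) + 2 + 1 = k + 3 := by ring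
      have e3 : (k : ℤ) + 2 - 1 = k + 1 := by ring
      simp only [add_sub_cancel_right, e1, e2, e3] at h0 h1 h2 ⊢
      constructor <;> linarith [h1.2, h2.2]

lemma hasSum_vonMisesCoeff (B : ℝ) (k : ℤ) :
    HasSum (fun m : ℕ => B ^ m / m.factorial * lazyWalkCoeff m k)
      (Real.exp B * vonMisesCoeff B k) := by
  have hexp : ∀ y : ℝ, HasSum (fun m : ℕ => y ^ m / m.factorial) (Real.exp y) := fun y => by
    rw [Real.exp_eq_exp_ℝ]
    exact NormedSpace.expSeries_div_hasSum_exp y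
  have h := intervalIntegral.hasSum_integral_of_dominated_convergence (μ := volume)
    (a := -π) (b := π)
    (F := fun (m : ℕ) x => B ^ m / m.factorial * ((1 + Real.cos x) ^ m * Real.cos (k * x)))
    (f := fun x => Real.exp (B * (1 + Real.cos x)) * Real.cos (k * x))
    (fun m _ => (2 * |B|) ^ m / m.factorial)
    (fun m => (Continuous.aestronglyMeasurable (by fun_prop)))
    (fun m => ae_of_all _ fun x _ => by
      have hc : |1 + Real.cos x| ≤ 2 := by
        rw [abs_le]; constructor <;> linarith [Real.neg_one_le_cos x, Real.cos_le_one x]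
      rw [Real.norm_eq_abs, abs_mul, abs_mul, abs_div, abs_pow, abs_pow, Nat.abs_cast, mul_pow]
      calc |B| ^ m / m.factorial * (|1 + Real.cos x| ^ m * |Real.cos (k * x)|)
          ≤ |B| ^ m / m.factorial * (2 ^ m * 1) := by
            gcongr
            exact Real.abs_cos_le_one _
        _ = _ := by ring)
    (ae_of_all _ fun x _ => (hexp _).summable)
    (by simp)
    (ae_of_all _ fun x _ => by
      have := (hexp (B * (1 + Real.cos x))).mul_right (Real.cos (k * x))
      refine this.congr_fun fun m => ?_
      rw [mul_pow]; ring)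
  simp only [intervalIntegral.integral_const_mul] at h
  convert! h using 1
  rw [vonMisesCoeff, ← intervalIntegral.integral_const_mul]
  congr 1 with x
  rw [mul_add, mul_one, Real.exp_add]
  ring

lemma vonMisesCoeff_nonneg {B : ℝ} (hB : 0 ≤ B) (k : ℕ) : 0 ≤ vonMisesCoeff B k := by
  have h : 0 ≤ Real.exp B * vonMisesCoeff B k :=
    (hasSum_vonMisesCoeff B k).nonneg fun m =>
      mul_nonneg (by positivity) (lazyWalkCoeff_unimodal m k).1
  exact nonneg_of_mul_nonneg_right h (Real.exp_pos B)

lemma vonMisesCoeff_succ_le {B : ℝ} (hB : 0 ≤ B) (k : ℕ) :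
    vonMisesCoeff B (k + 1) ≤ vonMisesCoeff B k := by
  refine le_of_mul_le_mul_left ?_ (Real.exp_pos B)
  exact hasSum_le (fun m => mul_le_mul_of_nonneg_left (lazyWalkCoeff_unimodal m k).2
    (by positivity)) (hasSum_vonMisesCoeff B (k + 1)) (hasSum_vonMisesCoeff B k)

lemma vonMisesCoeff_le_zero {B : ℝ} (hB : 0 ≤ B) (k : ℕ) :
    vonMisesCoeff B k ≤ vonMisesCoeff B 0 := by
  induction k with
  | zero => simp
  | succ k ih => exact_mod_cast (vonMisesCoeff_succ_le hB k).trans ih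

lemma vonMisesCoeff_neg (B : ℝ) (k : ℤ) : vonMisesCoeff B (-k) = vonMisesCoeff B k := by
  simp [vonMisesCoeff]

lemma vonMisesCoeff_natAbs (B : ℝ) (k : ℤ) : vonMisesCoeff B k.natAbs = vonMisesCoeff B k := by
  rcases Int.natAbs_eq k with h | h
  · rw [← h]
  · conv_rhs => rw [h, vonMisesCoeff_neg]

lemma vonMisesCoeff_zero_pos (B : ℝ) : 0 < vonMisesCoeff B 0 := by
  unfold vonMisesCoeff
  refine intervalIntegral.intervalIntegral_pos_of_pos
    (Continuous.intervalIntegrable (by fun_prop) _ _) (fun x => ?_) (by linarith [Real.pi_pos])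
  simp [Real.exp_pos]

/-- The Bessel recurrence, obtained by integrating by parts. -/
lemma vonMisesCoeff_recurrence (B : ℝ) (k : ℤ) :
    B * (vonMisesCoeff B (k - 1) - vonMisesCoeff B (k + 1)) = 2 * k * vonMisesCoeff B k := by
  have hderiv : ∀ x : ℝ, HasDerivAt (fun x => Real.exp (B * Real.cos x) * Real.sin (k * x))
      (Real.exp (B * Real.cos x) * (B * -Real.sin x) * Real.sin (k * x) +
        Real.exp (B * Real.cos x) * (Real.cos (k * x) * k)) x := fun x => by
    have h1 := ((Real.hasDerivAt_cos x).const_mul B).exp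
    have h2 : HasDerivAt (fun x => Real.sin (k * x)) (Real.cos (k * x) * k) x := by
      simpa using ((hasDerivAt_id x).const_mul (k : ℝ)).sin
    exact h1.mul h2
  have hint := intervalIntegral.integral_eq_sub_of_hasDerivAt (a := -π) (b := π)
    (fun x _ => hderiv x) (Continuous.intervalIntegrable (by fun_prop) _ _)
  have hs : Real.sin (k * π) = 0 := Real.sin_int_mul_pi k
  rw [mul_neg, Real.sin_neg, hs] at hint
  simp only [mul_zero, neg_zero, sub_zero] at hint
  unfold vonMisesCoeff
  rw [← intervalIntegral.integral_sub, ← intervalIntegral.integral_const_mul,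
    ← intervalIntegral.integral_const_mul, ← sub_eq_zero, ← intervalIntegral.integral_sub,
    ← mul_zero (-2 : ℝ), ← hint, ← intervalIntegral.integral_const_mul]
  · congr 1 with x
    push_cast
    have h1 : ((k : ℝ) - 1) * x = k * x - x := by ring
    have h2 : ((k : ℝ) + 1) * x = k * x + x := by ring
    rw [h1, h2, Real.cos_sub, Real.cos_add]
    ring
  all_goals exact Continuous.intervalIntegrable (by fun_prop) _ _

lemma vonMisesCoeff_add_two_le {B : ℝ} (hB : 0 < B) (k : ℕ) :
    (1 + 2 * (k + 1) / B) * vonMisesCoeff B (k + 2 : ℕ) ≤ vonMisesCoeff B k := by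
  have h := vonMisesCoeff_recurrence B (k + 1)
  have hm := vonMisesCoeff_succ_le hB.le (k + 1)
  push_cast at *
  have e : (k : ℤ) + 1 + 1 = k + 2 := by ring
  rw [add_sub_cancel_right, e] at h
  rw [e] at hm
  have h' : vonMisesCoeff B k =
      vonMisesCoeff B (k + 2) + 2 * (k + 1) / B * vonMisesCoeff B (k + 1) := by
    field_simp
    linarith
  rw [h', add_mul, one_mul]
  gcongr

/-- The powers of the normalised coefficients decay geometrically, uniformly as long as the power
is at least a fixed multiple of `B`. -/
lemma exists_vonMisesCoeff_ratio_pow_le {c : ℝ} (hc : 0 < c) :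
    ∃ C : ℝ, ∀ B : ℝ, 0 < B → ∀ n : ℕ, c * B ≤ n → ∀ k : ℤ,
      (vonMisesCoeff B k / vonMisesCoeff B 0) ^ n ≤ C * (1 / 2) ^ k.natAbs := by
  obtain ⟨K, hK⟩ := exists_nat_gt (3 / (2 * c))
  refine ⟨2 ^ (K + 2), fun B hB n hn k => ?_⟩
  rw [← vonMisesCoeff_natAbs]
  generalize k.natAbs = j
  have h0 := vonMisesCoeff_zero_pos B
  induction j using Nat.strong_induction_on with
  | _ j ih =>
  by_cases hj : j ≤ K + 2
  · have h1 : (vonMisesCoeff B j / vonMisesCoeff B 0) ^ n ≤ 1 :=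
      pow_le_one₀ (div_nonneg (vonMisesCoeff_nonneg hB.le j) h0.le)
        ((div_le_one h0).2 (vonMisesCoeff_le_zero hB.le j))
    refine h1.trans ?_
    rw [one_div, inv_pow, ← div_eq_mul_inv, one_le_div (by positivity)]
    exact pow_le_pow_right₀ (by norm_num) hj
  · obtain ⟨i, rfl⟩ : ∃ i, j = i + 2 := ⟨j - 2, by omega⟩
    have hi : (K : ℝ) ≤ i := by exact_mod_cast (by omega : K ≤ i)
    have hpow : 4 ≤ (1 + 2 * ((i : ℝ) + 1) / B) ^ n := by
      have hbern := one_add_mul_le_pow (a := 2 * ((i : ℝ) + 1) / B)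
        (by linarith [show 0 ≤ 2 * ((i : ℝ) + 1) / B by positivity]) n
      refine le_trans ?_ hbern
      have h3 : 3 < K * (2 * c) := (div_lt_iff₀ (by positivity)).1 hK
      have h4 : c ≤ n / B := (le_div_iff₀ hB).2 hn
      have h5 : K * (2 * c) ≤ ((i : ℝ) + 1) * (2 * (n / B)) := by
        gcongr
        linarith
      have h6 : (n : ℝ) * (2 * ((i : ℝ) + 1) / B) = ((i : ℝ) + 1) * (2 * (n / B)) := by ring
      linarith
    have hstep : (1 + 2 * ((i : ℝ) + 1) / B) ^ n *
        (vonMisesCoeff B (i + 2 : ℕ) / vonMisesCoeff B 0) ^ n ≤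
          (vonMisesCoeff B i / vonMisesCoeff B 0) ^ n := by
      rw [← mul_pow, ← mul_div_assoc]
      have := vonMisesCoeff_nonneg hB.le (i + 2)
      gcongr
      exact vonMisesCoeff_add_two_le hB i
    have hnn : 0 ≤ (vonMisesCoeff B (i + 2 : ℕ) / vonMisesCoeff B 0) ^ n :=
      pow_nonneg (div_nonneg (vonMisesCoeff_nonneg hB.le _) h0.le) _
    have := ih i (by omega)
    rw [pow_add (1 / 2 : ℝ) i 2]
    nlinarith

lemma summable_half_pow_natAbs : Summable fun k : ℤ => (1 / 2 : ℝ) ^ k.natAbs := by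
  refine Summable.of_nat_of_neg ?_ ?_ <;> simpa using summable_geometric_two

lemma summable_vonMisesCoeff {B : ℝ} (hB : 0 < B) : Summable (vonMisesCoeff B) := by
  obtain ⟨C, hC⟩ := exists_vonMisesCoeff_ratio_pow_le (inv_pos.2 hB)
  have h0 := vonMisesCoeff_zero_pos B
  refine ((summable_half_pow_natAbs.mul_left C).mul_left (vonMisesCoeff B 0)).of_nonneg_of_le
    (fun k => ?_) (fun k => ?_)
  · rw [← vonMisesCoeff_natAbs]
    exact vonMisesCoeff_nonneg hB.le _
  · have := hC B hB 1 (by rw [inv_mul_cancel₀ hB.ne']; simp) k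
    rw [pow_one, div_le_iff₀ h0] at this
    linarith

lemma tendsto_sq_mul_one_sub_cos_div (t : ℝ) :
    Tendsto (fun s : ℝ => s ^ 2 * (1 - Real.cos (t / s))) atTop (nhds (t ^ 2 / 2)) := by
  have h0 : Tendsto (fun s : ℝ => t / s / 2) atTop (nhds 0) := by
    simpa using (tendsto_const_nhds.div_atTop tendsto_id : Tendsto (fun s : ℝ => t / s) atTop
      (nhds 0)).div_const 2
  have h1 := ((Real.continuous_sinc.tendsto 0).comp h0).pow 2 |>.const_mul (t ^ 2 / 2)
  rw [Real.sinc_zero, one_pow, mul_one] at h1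
  refine h1.congr' ?_
  filter_upwards [eventually_gt_atTop 0] with s hs
  rcases eq_or_ne t 0 with rfl | ht
  · simp
  have hcos : Real.cos (t / s) = 1 - 2 * Real.sin (t / s / 2) ^ 2 := by
    have := Real.cos_two_mul' (t / s / 2)
    rw [mul_div_cancel₀ _ two_ne_zero] at this
    linarith [Real.sin_sq_add_cos_sq (t / s / 2)]
  rw [Function.comp_apply, Real.sinc_of_ne_zero (by positivity), hcos]
  field_simp
  ring

lemma sq_mul_one_sub_cos_div_le (t s : ℝ) : s ^ 2 * (1 - Real.cos (t / s)) ≤ t ^ 2 / 2 := by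
  rcases eq_or_ne s 0 with rfl | hs
  · simp; positivity
  · have h := Real.one_sub_sq_div_two_le_cos (x := t / s)
    calc s ^ 2 * (1 - Real.cos (t / s)) ≤ s ^ 2 * ((t / s) ^ 2 / 2) := by gcongr; linarith
      _ = t ^ 2 / 2 := by field_simp

/-- Laplace's method at the maximum of `cos`, in the rescaled variable. -/
lemma tendsto_integral_exp_cos_rescaled {F : ℝ → ℝ → ℝ} {G D : ℝ → ℝ}
    (hF : ∀ s, Continuous (F s)) (hD : Integrable fun y => Real.exp (-(2 / π ^ 2) * y ^ 2) * D y)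
    (hFD : ∀ s y, |F s y| ≤ D y) (hlim : ∀ y, Tendsto (fun s => F s y) atTop (nhds (G y))) :
    Tendsto (fun s : ℝ => ∫ y in (-π * s)..(π * s),
        Real.exp (-(s ^ 2 * (1 - Real.cos (y / s)))) * F s y) atTop
      (nhds (∫ y, Real.exp (-(y ^ 2 / 2)) * G y)) := by
  have hconv : ∀ᶠ s : ℝ in atTop,
      ∫ y, (Set.Ioc (-π * s) (π * s)).indicator
        (fun y => Real.exp (-(s ^ 2 * (1 - Real.cos (y / s)))) * F s y) y =
      ∫ y in (-π * s)..(π * s), Real.exp (-(s ^ 2 * (1 - Real.cos (y / s)))) * F s y := by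
    filter_upwards [eventually_ge_atTop 0] with s hs
    rw [integral_indicator measurableSet_Ioc, intervalIntegral.integral_of_le]
    nlinarith [Real.pi_pos]
  refine Tendsto.congr' hconv (tendsto_integral_filter_of_dominated_convergence
    (fun y => Real.exp (-(2 / π ^ 2) * y ^ 2) * D y) ?_ ?_ hD ?_)
  · refine Eventually.of_forall fun s => ?_
    have := hF s
    exact (Continuous.aestronglyMeasurable (by fun_prop)).indicator measurableSet_Ioc
  · filter_upwards [eventually_gt_atTop 0] with s hs
    refine ae_of_all _ fun y => ?_
    have hD0 : 0 ≤ D y := (abs_nonneg _).trans (hFD s y)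
    by_cases hy : y ∈ Set.Ioc (-π * s) (π * s)
    · rw [Set.indicator_of_mem hy, Real.norm_eq_abs, abs_mul, Real.abs_exp]
      refine mul_le_mul (Real.exp_le_exp.2 ?_) (hFD s y) (abs_nonneg _) (Real.exp_pos _).le
      have hys : |y / s| ≤ π := by
        rw [abs_le, le_div_iff₀ hs, div_le_iff₀ hs]
        exact ⟨hy.1.le, hy.2⟩
      have hc := Real.cos_le_one_sub_mul_cos_sq hys
      have : s ^ 2 * (2 / π ^ 2 * (y / s) ^ 2) ≤ s ^ 2 * (1 - Real.cos (y / s)) := by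
        gcongr; linarith
      have e : s ^ 2 * (2 / π ^ 2 * (y / s) ^ 2) = 2 / π ^ 2 * y ^ 2 := by field_simp
      linarith
    · rw [Set.indicator_of_notMem hy, norm_zero]
      exact mul_nonneg (Real.exp_pos _).le hD0
  · refine ae_of_all _ fun y => ?_
    have hlim' := ((Real.continuous_exp.tendsto _).comp
      (tendsto_sq_mul_one_sub_cos_div y).neg).mul (hlim y)
    refine hlim'.congr' ?_
    have hev : ∀ᶠ s : ℝ in atTop, |y| < π * s :=
      (tendsto_id.const_mul_atTop Real.pi_pos).eventually_gt_atTop _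
    filter_upwards [hev] with s hs
    rw [abs_lt] at hs
    have hy : y ∈ Set.Ioc (-π * s) (π * s) := ⟨by linarith [hs.1], hs.2.le⟩
    rw [Set.indicator_of_mem hy]
    rfl

lemma integral_exp_neg_sq_div_two_mul_sq :
    ∫ y : ℝ, Real.exp (-(y ^ 2 / 2)) * y ^ 2 = √(2 * π) := by
  have h := ProbabilityTheory.variance_fun_id_gaussianReal (μ := 0) (v := 1)
  rw [ProbabilityTheory.variance_eq_integral measurable_id'.aemeasurable,
    ProbabilityTheory.integral_id_gaussianReal,
    ProbabilityTheory.integral_gaussianReal_eq_integral_smul one_ne_zero] at h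
  simp only [ProbabilityTheory.gaussianPDFReal, sub_zero, NNReal.coe_one, mul_one, smul_eq_mul,
    mul_assoc, integral_const_mul] at h
  rw [inv_mul_eq_one₀ (by positivity)] at h
  rw [h]
  congr 1 with y
  rw [neg_div]

lemma integral_exp_neg_sq_div_two : ∫ y : ℝ, Real.exp (-(y ^ 2 / 2)) = √(2 * π) := by
  have h := integral_gaussian (1 / 2)
  rw [show π / (1 / 2) = 2 * π by ring] at h
  rw [← h]
  congr 1 with y
  ring_nf

lemma tendsto_mul_one_sub_vonMisesCoeff_ratio (k : ℤ) :
    Tendsto (fun B : ℝ => B * (1 - vonMisesCoeff B k / vonMisesCoeff B 0)) atTop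
      (nhds ((k : ℝ) ^ 2 / 2)) := by
  have hpos : (0 : ℝ) < 2 / π ^ 2 := by positivity
  have hnum := tendsto_integral_exp_cos_rescaled
    (F := fun s y => s ^ 2 * (1 - Real.cos (k * y / s)))
    (G := fun y => (k * y) ^ 2 / 2) (D := fun y => (k * y) ^ 2 / 2)
    (fun s => by fun_prop)
    (by
      have := (integrable_rpow_mul_exp_neg_mul_sq hpos (s := 2) (by norm_num)).const_mul
        ((k : ℝ) ^ 2 / 2)
      refine this.congr (ae_of_all _ fun y => ?_)
      simp only [Real.rpow_two]
      ring)
    (fun s y => by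
      rw [abs_of_nonneg (mul_nonneg (sq_nonneg s) (by linarith [Real.cos_le_one (k * y / s)]))]
      exact sq_mul_one_sub_cos_div_le _ _)
    (fun y => tendsto_sq_mul_one_sub_cos_div _)
  have hden := tendsto_integral_exp_cos_rescaled
    (F := fun _ _ => 1) (G := fun _ => 1) (D := fun _ => 1) (fun _ => continuous_const)
    (by simpa using integrable_exp_neg_mul_sq hpos) (fun _ _ => by simp)
    (fun _ => tendsto_const_nhds)
  have hG : ∫ y : ℝ, Real.exp (-(y ^ 2 / 2)) * ((k * y) ^ 2 / 2) =
      (k : ℝ) ^ 2 / 2 * √(2 * π) := by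
    rw [← integral_exp_neg_sq_div_two_mul_sq, ← integral_const_mul]
    congr 1 with y
    ring
  simp only [mul_one, integral_exp_neg_sq_div_two] at hden
  rw [hG] at hnum
  have hq := hnum.div hden (by positivity)
  rw [mul_div_cancel_right₀ _ (by positivity)] at hq
  refine (hq.comp Real.tendsto_sqrt_atTop).congr' ?_
  filter_upwards [eventually_gt_atTop 0] with B hB
  have hs : 0 < √B := Real.sqrt_pos.2 hB
  have hscale : ∀ f : ℝ → ℝ, ∫ y in (-π * √B)..(π * √B), f (y / √B) =
      √B * ∫ x in (-π)..π, f x := fun f => by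
    rw [intervalIntegral.integral_comp_div f hs.ne', smul_eq_mul, mul_div_cancel_right₀ _ hs.ne',
      mul_div_cancel_right₀ _ hs.ne']
  have hexp : ∀ x : ℝ, Real.exp (-(B * (1 - Real.cos x))) =
      Real.exp (-B) * Real.exp (B * Real.cos x) := fun x => by
    rw [← Real.exp_add]; ring_nf
  have h1 := hscale fun x => Real.exp (-(B * (1 - Real.cos x)))
  have h2 := hscale fun x =>
    Real.exp (-(B * (1 - Real.cos x))) * (B * (1 - Real.cos (k * x)))
  have h3 : ∫ x in (-π)..π, Real.exp (-(B * (1 - Real.cos x))) =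
      Real.exp (-B) * vonMisesCoeff B 0 := by
    rw [vonMisesCoeff, ← intervalIntegral.integral_const_mul]
    congr 1 with x
    simp [hexp]
  have h4 : ∫ x in (-π)..π, Real.exp (-(B * (1 - Real.cos x))) * (B * (1 - Real.cos (k * x))) =
      Real.exp (-B) * (B * (vonMisesCoeff B 0 - vonMisesCoeff B k)) := by
    rw [vonMisesCoeff, vonMisesCoeff, ← intervalIntegral.integral_sub,
      ← intervalIntegral.integral_const_mul, ← intervalIntegral.integral_const_mul]
    · congr 1 with x
      rw [hexp]
      simp
      ring
    all_goals exact Continuous.intervalIntegrable (by fun_prop) _ _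
  simp only [Function.comp_apply, Pi.div_apply, Real.sq_sqrt hB.le, mul_div_assoc]
  rw [h1, h2, h3, h4]
  have := vonMisesCoeff_zero_pos B
  field_simp

lemma integral_exp_cos_mul_sin (B : ℝ) (k : ℤ) :
    ∫ x in (-π)..π, Real.exp (B * Real.cos x) * Real.sin (k * x) = 0 := by
  have h := intervalIntegral.integral_comp_neg (a := -π) (b := π)
    fun x => Real.exp (B * Real.cos x) * Real.sin (k * x)
  simp only [Real.cos_neg, mul_neg, Real.sin_neg, neg_neg, intervalIntegral.integral_neg] at h
  linarith

lemma hasSum_vonMisesCoeff_mul_cos {B : ℝ} (hB : 0 < B) (x : ℝ) :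
    HasSum (fun k : ℤ => vonMisesCoeff B k * Real.cos (k * x))
      (2 * π * Real.exp (B * Real.cos x)) := by
  have hT : Fact (0 < 2 * π) := ⟨Real.two_pi_pos⟩
  have hper : Function.Periodic (fun x : ℝ => (Real.exp (B * Real.cos x) : ℂ)) (2 * π) :=
    fun x => by simp
  let f : C(AddCircle (2 * π), ℂ) := ⟨hper.lift, continuous_coinduced_dom.2 (by
    change Continuous fun x : ℝ => (Real.exp (B * Real.cos x) : ℂ)
    fun_prop)⟩
  have hf : ∀ y : ℝ, f y = (Real.exp (B * Real.cos y) : ℂ) := fun y => hper.lift_coe y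
  have hcoeff : ∀ k : ℤ,
      fourierCoeff f k = ((1 / (2 * π) * vonMisesCoeff B k : ℝ) : ℂ) := fun k => by
    have hval : ∀ y : ℝ, fourier (-k) (y : AddCircle (2 * π)) • f y =
        ((Real.exp (B * Real.cos y) * Real.cos (k * y) : ℝ) : ℂ) -
          ((Real.exp (B * Real.cos y) * Real.sin (k * y) : ℝ) : ℂ) * Complex.I := fun y => by
      have e : 2 * π * Complex.I * ((-k : ℤ) : ℂ) * y / ((2 * π : ℝ) : ℂ) =
          ((-(k * y) : ℝ) : ℂ) * Complex.I := by
        have : (π : ℂ) ≠ 0 := by exact_mod_cast Real.pi_ne_zero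
        push_cast
        field_simp
      rw [fourier_coe_apply, hf, e, Complex.exp_mul_I, ← Complex.ofReal_cos, ← Complex.ofReal_sin,
        Real.cos_neg, Real.sin_neg, smul_eq_mul]
      push_cast
      ring
    rw [fourierCoeff_eq_intervalIntegral f k (-π), show -π + 2 * π = π by ring]
    simp_rw [hval]
    rw [intervalIntegral.integral_sub, intervalIntegral.integral_mul_const,
      intervalIntegral.integral_ofReal, intervalIntegral.integral_ofReal,
      integral_exp_cos_mul_sin, ← vonMisesCoeff]
    · simp
    all_goals exact Continuous.intervalIntegrable (by fun_prop) _ _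
  have hsum : Summable (fourierCoeff f) := by
    simp_rw [funext hcoeff]
    exact Complex.ofRealCLM.summable ((summable_vonMisesCoeff hB).mul_left _)
  have h := Complex.hasSum_re (has_pointwise_sum_fourier_series_of_summable hsum x)
  rw [hf, Complex.ofReal_re] at h
  have h' := h.mul_left (2 * π)
  refine h'.congr_fun fun k => ?_
  rw [hcoeff, fourier_coe_apply, smul_eq_mul, Complex.re_ofReal_mul]
  have e : 2 * π * Complex.I * k * x / ((2 * π : ℝ) : ℂ) = ((k * x : ℝ) : ℂ) * Complex.I := by
    have : (π : ℂ) ≠ 0 := by exact_mod_cast Real.pi_ne_zero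
    push_cast
    field_simp
  rw [e, Complex.exp_ofReal_mul_I_re]
  field_simp

lemma continuous_chainNode (n : ℕ) (α β : ℝ) (j : ℕ) :
    Continuous fun θ : Fin (n - 1) → ℝ => chainNode n α β θ j := by
  unfold chainNode
  split_ifs <;> fun_prop

lemma chainNode_cons_succ (m : ℕ) (α β γ : ℝ) (θ : Fin m → ℝ) (j : ℕ) :
    chainNode (m + 2) α β (Fin.cons γ θ : Fin (m + 1) → ℝ) (j + 1) =
      chainNode (m + 1) γ β θ j := by
  rcases j with _ | j
  · simp [chainNode]
  · simp only [chainNode, Nat.add_one_ne_zero, if_false, Nat.add_sub_cancel]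
    by_cases hj : j < m
    · have h1 : j + 1 < m + 2 - 1 := by omega
      rw [dif_pos h1, dif_pos hj]
      exact Fin.cons_succ (α := fun _ => ℝ) γ θ ⟨j, hj⟩
    · have h1 : ¬ j + 1 < m + 2 - 1 := by omega
      rw [dif_neg h1, dif_neg hj]

lemma integrable_chain_weight (n : ℕ) {B : ℝ} (hB : 0 ≤ B) (α β : ℝ) :
    Integrable (fun θ : Fin (n - 1) → ℝ => Real.exp (B * ∑ j ∈ Finset.range n,
        Real.cos (chainNode n α β θ (j + 1) - chainNode n α β θ j)))
      (Measure.pi fun _ => volume.restrict (Set.Ioc (-π) π)) := by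
  have hc := continuous_chainNode n α β
  refine Integrable.of_bound (C := Real.exp (B * n))
    (Continuous.aestronglyMeasurable (by fun_prop)) (ae_of_all _ fun θ => ?_)
  rw [Real.norm_eq_abs, Real.abs_exp]
  gcongr
  calc _ ≤ ∑ j ∈ Finset.range n, (1 : ℝ) := Finset.sum_le_sum fun j _ => Real.cos_le_one _
    _ = n := by simp

lemma chainZ_one (B α β : ℝ) : chainZ 1 B α β = Real.exp (B * Real.cos (β - α)) := by
  have : IsEmpty (Fin (1 - 1)) := inferInstanceAs (IsEmpty (Fin 0))
  rw [chainZ, Measure.pi_of_empty, integral_dirac]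
  simp [chainNode]

/-- Transfer-operator recursion: the first interior angle is integrated last. -/
lemma chainZ_add_two (m : ℕ) {B : ℝ} (hB : 0 ≤ B) (α β : ℝ) :
    chainZ (m + 2) B α β =
      ∫ γ in (-π)..π, Real.exp (B * Real.cos (γ - α)) * chainZ (m + 1) B γ β := by
  have hpi : -π ≤ π := by linarith [Real.pi_pos]
  have hmp := (measurePreserving_piFinSuccAbove
    (fun _ : Fin (m + 1) => (volume : Measure ℝ).restrict (Set.Ioc (-π) π)) 0).symm
  have hint := integrable_chain_weight (m + 2) hB α β
  rw [intervalIntegral.integral_of_le hpi]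
  unfold chainZ
  simp only [← integral_const_mul]
  refine (hmp.integral_comp' _).symm.trans ?_
  rw [integral_prod]
  · congr 1 with γ
    congr 1 with θ
    rw [← Real.exp_add, ← mul_add, Finset.sum_range_succ']
    have hcons : (MeasurableEquiv.piFinSuccAbove (fun _ : Fin (m + 1) => ℝ) 0).symm (γ, θ) =
        (Fin.cons γ θ : Fin (m + 1) → ℝ) := by
      simp [MeasurableEquiv.piFinSuccAbove, Fin.insertNthEquiv]
    rw [hcons]
    simp only [chainNode_cons_succ]
    rw [add_comm]
    simp [chainNode]
  · exact (hmp.integrable_comp_emb (MeasurableEquiv.measurableEmbedding _)).2 hint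

lemma integral_exp_cos_mul_cos_shift (B : ℝ) (k : ℤ) (α β : ℝ) :
    ∫ γ in (-π)..π, Real.exp (B * Real.cos (γ - α)) * Real.cos (k * (β - γ)) =
      vonMisesCoeff B k * Real.cos (k * (β - α)) := by
  let g : ℝ → ℝ := fun x => Real.exp (B * Real.cos x) * Real.cos (k * (β - α) - k * x)
  have hg : Function.Periodic g (2 * π) := fun x => by
    have : (k : ℝ) * (β - α) - k * (x + 2 * π) = k * (β - α) - k * x - k * (2 * π) := by ring
    simp only [g]
    rw [Real.cos_add_two_pi, this, Real.cos_sub_int_mul_two_pi]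
  calc ∫ γ in (-π)..π, Real.exp (B * Real.cos (γ - α)) * Real.cos (k * (β - γ))
      = ∫ γ in (-π)..π, g (γ - α) := by
        congr 1 with γ
        simp only [g]
        ring_nf
    _ = ∫ x in (-π - α)..(-π - α + 2 * π), g x := by
        rw [intervalIntegral.integral_comp_sub_right]
        congr 1
        ring
    _ = ∫ x in (-π)..(-π + 2 * π), g x := hg.intervalIntegral_add_eq _ _
    _ = ∫ x in (-π)..π, (Real.exp (B * Real.cos x) * Real.cos (k * x) * Real.cos (k * (β - α)) +
          Real.exp (B * Real.cos x) * Real.sin (k * x) * Real.sin (k * (β - α))) := by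
        rw [show -π + 2 * π = π by ring]
        congr 1 with x
        simp only [g, Real.cos_sub]
        ring
    _ = _ := by
        rw [intervalIntegral.integral_add, intervalIntegral.integral_mul_const,
          intervalIntegral.integral_mul_const, integral_exp_cos_mul_sin, zero_mul, add_zero, vonMisesCoeff]
        all_goals exact Continuous.intervalIntegrable (by fun_prop) _ _

lemma vonMisesCoeff_int_nonneg {B : ℝ} (hB : 0 ≤ B) (k : ℤ) : 0 ≤ vonMisesCoeff B k := by
  rw [← vonMisesCoeff_natAbs]
  exact vonMisesCoeff_nonneg hB _

lemma vonMisesCoeff_int_le_zero {B : ℝ} (hB : 0 ≤ B) (k : ℤ) :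
    vonMisesCoeff B k ≤ vonMisesCoeff B 0 := by
  rw [← vonMisesCoeff_natAbs]
  exact vonMisesCoeff_le_zero hB _

lemma summable_vonMisesCoeff_pow {B : ℝ} (hB : 0 < B) (n : ℕ) :
    Summable fun k : ℤ => vonMisesCoeff B k ^ (n + 1) := by
  refine ((summable_vonMisesCoeff hB).mul_left (vonMisesCoeff B 0 ^ n)).of_nonneg_of_le
    (fun k => pow_nonneg (vonMisesCoeff_int_nonneg hB.le k) _) fun k => ?_
  have := vonMisesCoeff_int_nonneg hB.le k
  rw [pow_succ]
  gcongr
  exact vonMisesCoeff_int_le_zero hB.le k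

/-- Fourier expansion of the partition function in the boundary-angle difference. -/
lemma hasSum_chainZ {B : ℝ} (hB : 0 < B) (n : ℕ) (α β : ℝ) :
    HasSum (fun k : ℤ => vonMisesCoeff B k ^ (n + 1) * Real.cos (k * (β - α)))
      (2 * π * chainZ (n + 1) B α β) := by
  induction n generalizing α with
  | zero => simpa [chainZ_one] using hasSum_vonMisesCoeff_mul_cos hB (β - α)
  | succ n ih =>
    have h := intervalIntegral.hasSum_integral_of_dominated_convergence (μ := volume)
      (a := -π) (b := π)
      (F := fun (k : ℤ) γ => vonMisesCoeff B k ^ (n + 1) *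
        (Real.exp (B * Real.cos (γ - α)) * Real.cos (k * (β - γ))))
      (f := fun γ => 2 * π * (Real.exp (B * Real.cos (γ - α)) * chainZ (n + 1) B γ β))
      (fun k _ => vonMisesCoeff B k ^ (n + 1) * Real.exp B)
      (fun k => (Continuous.aestronglyMeasurable (by fun_prop)))
      (fun k => ae_of_all _ fun γ _ => by
        have hk := vonMisesCoeff_int_nonneg hB.le k
        rw [Real.norm_eq_abs, abs_mul, abs_mul, Real.abs_exp, abs_of_nonneg (pow_nonneg hk _)]
        gcongr
        rw [← mul_one (Real.exp B)]
        gcongr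
        · nlinarith [Real.cos_le_one (γ - α)]
        · exact Real.abs_cos_le_one _)
      (ae_of_all _ fun γ _ => (summable_vonMisesCoeff_pow hB n).mul_right _)
      (by simp)
      (ae_of_all _ fun γ _ => by
        have h1 := (ih γ).mul_left (Real.exp (B * Real.cos (γ - α)))
        convert! h1 using 1
        · ext k; ring
        · ring)
    simp only [intervalIntegral.integral_const_mul, integral_exp_cos_mul_cos_shift] at h
    rw [← chainZ_add_two n hB.le] at h
    refine h.congr_fun fun k => ?_
    ring

lemma hasSum_wrappedGaussian {b : ℝ} (hb : 0 < b) (Δ : ℝ) :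
    HasSum (fun m : ℤ => Real.exp (-(b / 2) * (Δ + 2 * π * m) ^ 2))
      (HurwitzZeta.evenKernel (Δ / (2 * π) : ℝ) (2 * π * b)) := by
  refine (HurwitzZeta.hasSum_int_evenKernel (Δ / (2 * π)) (by positivity)).congr_fun fun m => ?_
  congr 1
  field_simp
  ring

lemma wrappedGaussian_pos {b : ℝ} (hb : 0 < b) (Δ : ℝ) : 0 < wrappedGaussian b Δ :=
  (hasSum_wrappedGaussian hb Δ).summable.tsum_pos (fun _ => (Real.exp_pos _).le) 0
    (Real.exp_pos _)

/-- Poisson summation for the wrapped Gaussian. -/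
lemma tsum_exp_mul_cos_eq_wrappedGaussian {b : ℝ} (hb : 0 < b) (Δ : ℝ) :
    ∑' k : ℤ, Real.exp (-((k : ℝ) ^ 2 / (2 * b))) * Real.cos (k * Δ) =
      √(2 * π * b) * wrappedGaussian b Δ := by
  have ht : 0 < 2 * π * b := by positivity
  have hfe := HurwitzZeta.evenKernel_functional_equation (Δ / (2 * π) : ℝ) (2 * π * b)
  rw [← (hasSum_wrappedGaussian hb Δ).tsum_eq, ← Real.sqrt_eq_rpow] at hfe
  have h := Complex.hasSum_re
    (HurwitzZeta.hasSum_int_cosKernel (Δ / (2 * π)) (one_div_pos.2 ht))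
  rw [Complex.ofReal_re] at h
  rw [wrappedGaussian, hfe, ← mul_assoc, mul_one_div_cancel (Real.sqrt_pos.2 ht).ne', one_mul,
    ← h.tsum_eq]
  congr 1 with k
  have e : 2 * π * Complex.I * ((Δ / (2 * π) : ℝ) : ℂ) * k = ((k * Δ : ℝ) : ℂ) * Complex.I := by
    have : (π : ℂ) ≠ 0 := by exact_mod_cast Real.pi_ne_zero
    push_cast
    field_simp
  rw [e, Complex.re_mul_ofReal, Complex.exp_ofReal_mul_I_re, mul_comm]
  congr 2
  field_simp

lemma tendsto_vonMisesCoeff_ratio_pow {B : ℕ → ℝ} {b : ℝ} (hb : 0 < b)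
    (hlim : Tendsto (fun n => B n / n) atTop (nhds b)) (k : ℤ) :
    Tendsto (fun n => (vonMisesCoeff (B n) k / vonMisesCoeff (B n) 0) ^ n) atTop
      (nhds (Real.exp (-((k : ℝ) ^ 2 / (2 * b))))) := by
  have hBtop : Tendsto B atTop atTop := by
    have := hlim.pos_mul_atTop hb tendsto_natCast_atTop_atTop
    refine this.congr' ?_
    filter_upwards [eventually_gt_atTop 0] with n hn
    have : (n : ℝ) ≠ 0 := by positivity
    field_simp
  have h1 := (tendsto_mul_one_sub_vonMisesCoeff_ratio k).comp hBtop
  have h2 := ((hlim.inv₀ hb.ne').mul h1).neg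
  have hlimit : -(b⁻¹ * ((k : ℝ) ^ 2 / 2)) = -((k : ℝ) ^ 2 / (2 * b)) := by
    field_simp
  rw [hlimit] at h2
  have h3 := Real.tendsto_one_add_pow_exp_of_tendsto
    (g := fun n => vonMisesCoeff (B n) k / vonMisesCoeff (B n) 0 - 1) (h2.congr' ?_)
  · simpa using h3
  · filter_upwards [hBtop.eventually_gt_atTop 0] with n hn
    simp only [Function.comp_apply, inv_div]
    field_simp
    ring

/-- The normalised partition function converges to the wrapped Gaussian density. -/
lemma tendsto_normalized_chainZ {B : ℕ → ℝ} (hB : ∀ n, 0 < B n) {b : ℝ} (hb : 0 < b)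
    (hlim : Tendsto (fun n => B n / n) atTop (nhds b)) (α β : ℝ) :
    Tendsto (fun n => 2 * π * chainZ n (B n) α β / vonMisesCoeff (B n) 0 ^ n) atTop
      (nhds (√(2 * π * b) * wrappedGaussian b (β - α))) := by
  obtain ⟨C, hC⟩ := exists_vonMisesCoeff_ratio_pow_le (c := (2 * b)⁻¹) (by positivity)
  have hT := tendsto_tsum_of_dominated_convergence (𝓕 := atTop)
    (f := fun (n : ℕ) (k : ℤ) =>
      (vonMisesCoeff (B n) k / vonMisesCoeff (B n) 0) ^ n * Real.cos (k * (β - α)))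
    (summable_half_pow_natAbs.mul_left C)
    (fun k => (tendsto_vonMisesCoeff_ratio_pow hb hlim k).mul_const (Real.cos (k * (β - α))))
    (by
      filter_upwards [hlim.eventually_lt_const (show b < 2 * b by linarith),
        eventually_gt_atTop 0] with n hn hn0 k
      have hn0' : (0 : ℝ) < n := by exact_mod_cast hn0
      have hcB : (2 * b)⁻¹ * B n ≤ n := by
        rw [div_lt_iff₀ hn0'] at hn
        rw [inv_mul_le_iff₀ (by positivity)]
        exact hn.le
      have hnn : 0 ≤ (vonMisesCoeff (B n) k / vonMisesCoeff (B n) 0) ^ n :=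
        pow_nonneg (div_nonneg (vonMisesCoeff_int_nonneg (hB n).le k)
          (vonMisesCoeff_zero_pos _).le) _
      rw [Real.norm_eq_abs, abs_mul, abs_of_nonneg hnn]
      exact (mul_le_of_le_one_right hnn (Real.abs_cos_le_one _)).trans (hC _ (hB n) n hcB k))
  rw [tsum_exp_mul_cos_eq_wrappedGaussian hb] at hT
  refine hT.congr' ?_
  filter_upwards [eventually_gt_atTop 0] with n hn
  obtain ⟨m, rfl⟩ := Nat.exists_eq_succ_of_ne_zero hn.ne'
  rw [← ((hasSum_chainZ (hB _) m α β).div_const _).tsum_eq]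
  congr 1 with k
  rw [div_pow, div_mul_eq_mul_div]

/-- Scaling limit of partition-function ratios for the 1D XY chain with Dirichlet
boundary conditions: if `B_n / n → b ∈ (0, ∞)`, then
`Z_n(B_n; α, β) / Z_n(B_n; α', β')` converges to the ratio of the corresponding
wrapped Gaussians. -/
theorem chainZ_ratio_tendsto (B : ℕ → ℝ) (hB : ∀ n, 0 < B n) (b : ℝ) (hb : 0 < b)
    (hlim : Tendsto (fun n => B n / n) atTop (nhds b)) (α β α' β' : ℝ) :
    Tendsto (fun n => chainZ n (B n) α β / chainZ n (B n) α' β') atTop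
      (nhds (wrappedGaussian b (β - α) / wrappedGaussian b (β' - α'))) := by
  have h1 := tendsto_normalized_chainZ hB hb hlim α β
  have h2 := tendsto_normalized_chainZ hB hb hlim α' β'
  have hw := wrappedGaussian_pos hb (β' - α')
  have h := h1.div h2 (by positivity)
  rw [mul_div_mul_left _ _ (by positivity)] at h
  refine h.congr fun n => ?_
  have := vonMisesCoeff_zero_pos (B n)
  have h2pi : 2 * π ≠ 0 := Real.two_pi_pos.ne'
  rw [Pi.div_apply, div_div_div_cancel_right₀ (by positivity), mul_div_mul_left _ _ h2pi]
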